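/- Let Γ be a group with a finite symmetric generating set S, equipped with the word metric d_S, and suppose Γ acts by isometries on a geodesic metric space X. Fix x₀ ∈ X and let n, k ∈ ℕ. Suppose that for every R > 0 the R-stabilizer W_R(x₀) = {g ∈ Γ : d_X(g·x₀, x₀) ≤ R}, viewed as a subspace of (Γ, d_S), satisfies asdim W_R(x₀) ≤ n. If asdim X ≤ k, then asdim Γ ≤ k + n. -/

import Mathlib

/-- `𝒰` is `r`-disjoint with respect to the distance function `d`. -/
def RDisjointD {α : Type*} (d : α → α → ℝ) (r : ℝ) (𝒰 : Set (Set α)) : Prop :=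
  ∀ U ∈ 𝒰, ∀ V ∈ 𝒰, U ≠ V → ∀ x ∈ U, ∀ y ∈ V, r < d x y

/-- `U` has diameter at most `D` with respect to the distance function `d`. -/
def DiamLED {α : Type*} (d : α → α → ℝ) (D : ℝ) (U : Set α) : Prop :=
  ∀ x ∈ U, ∀ y ∈ U, d x y ≤ D

/-- Asymptotic dimension at most `n` with respect to the distance function `d`. -/
def AsdimLED {α : Type*} (d : α → α → ℝ) (n : ℕ) : Prop :=
  ∀ r : ℝ, 0 < r → ∃ (𝒰 : Fin (n + 1) → Set (Set α)) (D : ℝ),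
    (∀ x : α, ∃ i, ∃ U ∈ 𝒰 i, x ∈ U) ∧
    (∀ i, RDisjointD d r (𝒰 i)) ∧
    (∀ i, ∀ U ∈ 𝒰 i, DiamLED d D U)

/-- The word norm of `g` with respect to the generating set `S`. -/
noncomputable def wordNorm {Γ : Type*} [Group Γ] (S : Set Γ) (g : Γ) : ℕ :=
  sInf {n : ℕ | ∃ l : List Γ, (∀ s ∈ l, s ∈ S) ∧ l.length = n ∧ l.prod = g}

/-- The word metric on `Γ` associated to the generating set `S`. -/
noncomputable def wordDist {Γ : Type*} [Group Γ] (S : Set Γ) (g h : Γ) : ℝ :=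
  (wordNorm S (g⁻¹ * h) : ℝ)

/-- A metric space is geodesic if every pair of points is joined by an isometrically embedded
segment. -/
def IsGeodesicSpace (X : Type*) [MetricSpace X] : Prop :=
  ∀ x y : X, ∃ γ : ℝ → X, γ 0 = x ∧ γ (dist x y) = y ∧
    ∀ s ∈ Set.Icc (0 : ℝ) (dist x y), ∀ t ∈ Set.Icc (0 : ℝ) (dist x y),
      dist (γ s) (γ t) = |s - t|

open Set

section CoarseCovers

variable {α : Type*} [PseudoMetricSpace α]

/-- `A` splits into pieces of diameter at most `D`, distinct pieces being more than `r` apart. -/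
def SplitsAtScale (r D : ℝ) (A : Set α) : Prop :=
  ∃ s : Setoid α, (∀ x ∈ A, ∀ y ∈ A, dist x y ≤ r → s x y) ∧
    ∀ x ∈ A, ∀ y ∈ A, s x y → dist x y ≤ D

open Classical in
/-- The indices below `m` of the sets among `A 0, …, A (m - 1)` not containing `x`. -/
noncomputable def missingIndices {α : Type*} (A : ℕ → Set α) (m : ℕ) (x : α) : Finset ℕ :=
  (Finset.range m).filter fun i => x ∉ A i

theorem mem_missingIndices {α : Type*} {A : ℕ → Set α} {m i : ℕ} {x : α} :
    i ∈ missingIndices A m x ↔ i < m ∧ x ∉ A i := by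
  simp [missingIndices]

theorem exists_mem_of_card_missingIndices_lt {α : Type*} {A : ℕ → Set α} {m : ℕ} {x : α}
    (h : (missingIndices A m x).card < m) : ∃ i < m, x ∈ A i := by
  by_contra! hno
  have : Finset.range m ⊆ missingIndices A m x := fun i hi =>
    mem_missingIndices.2 ⟨Finset.mem_range.1 hi, hno i (Finset.mem_range.1 hi)⟩
  have := Finset.card_le_card this
  rw [Finset.card_range] at this
  omega

/-- `Z` has `m` subsets, each splitting at scale `r` into pieces of diameter at most `D`, such that
every point of `Z` lies outside at most `n` of them. -/
def HasMultiCover (m n : ℕ) (r D : ℝ) (Z : Set α) : Prop :=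
  ∃ A : ℕ → Set α, (∀ i < m, SplitsAtScale r D (A i)) ∧
    ∀ x ∈ Z, (missingIndices A m x).card ≤ n

/-- The members of `𝒵` have, at every scale, multicovers with a common bound. -/
def UniformMultiCover (m n : ℕ) (𝒵 : Set (Set α)) : Prop :=
  ∀ r : ℝ, 0 < r → ∃ D : ℝ, 0 ≤ D ∧ ∀ Z ∈ 𝒵, HasMultiCover m n r D Z

theorem SplitsAtScale.of_label {ι : Type*} (l : α → ι) {r D : ℝ} {A : Set α}
    (h₁ : ∀ x ∈ A, ∀ y ∈ A, dist x y ≤ r → l x = l y)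
    (h₂ : ∀ x ∈ A, ∀ y ∈ A, l x = l y → dist x y ≤ D) : SplitsAtScale r D A :=
  ⟨Setoid.ker l, h₁, h₂⟩

theorem SplitsAtScale.exists_label {r D : ℝ} {A : Set α} (h : SplitsAtScale r D A) :
    ∃ l : α → Set α, (∀ x ∈ A, ∀ y ∈ A, dist x y ≤ r → l x = l y) ∧
      ∀ x ∈ A, ∀ y ∈ A, l x = l y → dist x y ≤ D := by
  obtain ⟨s, h₁, h₂⟩ := h
  refine ⟨fun x => {z | s x z}, fun x hx y hy hxy => ?_, fun x hx y hy hxy => ?_⟩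
  · have := h₁ x hx y hy hxy
    ext z
    exact ⟨fun hz => s.trans (s.symm this) hz, fun hz => s.trans this hz⟩
  · have hy' : y ∈ {z | s y z} := s.refl y
    rw [← show {z | s x z} = {z | s y z} from hxy] at hy'
    exact h₂ x hx y hy hy'

theorem SplitsAtScale.mono {r D : ℝ} {A B : Set α} (h : SplitsAtScale r D B) (hAB : A ⊆ B) :
    SplitsAtScale r D A := by
  obtain ⟨s, h₁, h₂⟩ := h
  exact ⟨s, fun x hx y hy => h₁ x (hAB hx) y (hAB hy), fun x hx y hy => h₂ x (hAB hx) y (hAB hy)⟩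

theorem SplitsAtScale.empty (r D : ℝ) : SplitsAtScale r D (∅ : Set α) :=
  ⟨⊤, by simp, by simp⟩

theorem SplitsAtScale.preimage {r D : ℝ} {A : Set α} (h : SplitsAtScale r D A)
    {φ : α → α} (hφ : Isometry φ) : SplitsAtScale r D (φ ⁻¹' A) := by
  obtain ⟨l, h₁, h₂⟩ := h.exists_label
  refine .of_label (l ∘ φ) (fun x hx y hy hxy => h₁ _ hx _ hy ?_) fun x hx y hy hxy => ?_
  · rwa [hφ.dist_eq]
  · rw [← hφ.dist_eq]
    exact h₂ _ hx _ hy hxy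

/-- The closed thickening of a split set still splits, at a smaller scale. -/
theorem SplitsAtScale.thicken {r D : ℝ} {A : Set α} (h : SplitsAtScale (3 * r) D A) :
    SplitsAtScale r (D + 2 * r) {x | ∃ a ∈ A, dist x a ≤ r} := by
  obtain ⟨l, h₁, h₂⟩ := h.exists_label
  choose! p hpA hp using fun (x : α) (hx : ∃ a ∈ A, dist x a ≤ r) => hx
  refine .of_label (l ∘ p) (fun x hx y hy hxy => h₁ _ (hpA x hx) _ (hpA y hy) ?_)
    fun x hx y hy hxy => ?_
  · have := dist_triangle4 (p x) x y (p y)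
    have hx' := hp x hx
    rw [dist_comm] at hx'
    linarith [hp y hy]
  · have := dist_triangle4 x (p x) (p y) y
    have hy' := hp y hy
    rw [dist_comm] at hy'
    linarith [hp x hx, h₂ _ (hpA x hx) _ (hpA y hy) hxy]

/-- Saturated union: pieces of `A` close to a piece of `B` are absorbed by it. -/
theorem SplitsAtScale.union {r D D' : ℝ} (hr : 0 < r) (hD : 0 ≤ D) (hD' : 0 ≤ D') {A B : Set α}
    (hA : SplitsAtScale r D A) (hB : SplitsAtScale (D + 2 * r) D' B) :
    SplitsAtScale r (D' + 2 * D + 2 * r) (A ∪ B) := by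
  classical
  obtain ⟨a, ha₁, ha₂⟩ := hA.exists_label
  obtain ⟨b, hb₁, hb₂⟩ := hB.exists_label
  let N : α → α → Prop := fun x z =>
    z ∈ B ∧ (x = z ∨ x ∈ A ∧ ∃ y ∈ A, a x = a y ∧ dist y z ≤ r)
  have hN_dist : ∀ x z, N x z → dist x z ≤ D + r := by
    rintro x z ⟨-, rfl | ⟨hx, y, hy, hxy, hyz⟩⟩
    · rw [dist_self]; positivity
    · linarith [dist_triangle x y z, ha₂ x hx y hy hxy]
  have hN_unique : ∀ x z w, N x z → N x w → b z = b w := by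
    intro x z w hz hw
    refine hb₁ z hz.1 w hw.1 ?_
    have h₁ := hN_dist x z hz
    have h₂ := hN_dist x w hw
    rcases hz.2 with rfl | ⟨hx, y, hy, hxy, hyz⟩
    · linarith
    rcases hw.2 with rfl | ⟨-, y', hy', hxy', hyw⟩
    · rw [dist_comm]; linarith
    · have := dist_triangle4 z y y' w
      rw [dist_comm z y] at this
      linarith [ha₂ y hy y' hy' (hxy.symm.trans hxy')]
  have hN_close : ∀ x ∈ A ∪ B, ∀ y ∈ A ∪ B, dist x y ≤ r → ∀ z, N x z →
      ∃ w, N y w ∧ b z = b w := by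
    intro x hx y hy hxy z hz
    by_cases hyB : y ∈ B
    · refine ⟨y, ⟨hyB, Or.inl rfl⟩, hb₁ z hz.1 y hyB ?_⟩
      have h₁ := dist_triangle z x y
      rw [dist_comm z x] at h₁
      linarith [hN_dist x z hz]
    · have hyA : y ∈ A := hy.resolve_right hyB
      refine ⟨z, ⟨hz.1, Or.inr ⟨hyA, ?_⟩⟩, rfl⟩
      rcases hz.2 with rfl | ⟨hxA, w, hw, hxw, hwz⟩
      · exact ⟨y, hyA, rfl, by rwa [dist_comm]⟩
      · exact ⟨w, hw, (ha₁ x hxA y hyA hxy).symm.trans hxw, hwz⟩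
  let l : α → Set α ⊕ Set α := fun x =>
    if h : ∃ z, N x z then Sum.inr (b h.choose) else Sum.inl (a x)
  have hl : ∀ x z, N x z → l x = Sum.inr (b z) := by
    intro x z hz
    have h : ∃ z, N x z := ⟨z, hz⟩
    simp only [l, dif_pos h]
    rw [hN_unique x _ z h.choose_spec hz]
  have hl' : ∀ x, (¬ ∃ z, N x z) → l x = Sum.inl (a x) := fun x h => dif_neg h
  have hmemA : ∀ x ∈ A ∪ B, (¬ ∃ z, N x z) → x ∈ A := fun x hx h =>
    hx.resolve_right fun hxB => h ⟨x, hxB, Or.inl rfl⟩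
  refine .of_label l (fun x hx y hy hxy => ?_) fun x hx y hy hxy => ?_
  · by_cases h : ∃ z, N x z
    · obtain ⟨z, hz⟩ := h
      obtain ⟨w, hw, hzw⟩ := hN_close x hx y hy hxy z hz
      rw [hl x z hz, hl y w hw, hzw]
    · have h' : ¬ ∃ z, N y z := fun ⟨z, hz⟩ => by
        obtain ⟨w, hw, -⟩ := hN_close y hy x hx (by rwa [dist_comm]) z hz
        exact h ⟨w, hw⟩
      rw [hl' x h, hl' y h', ha₁ x (hmemA x hx h) y (hmemA y hy h') hxy]
  · by_cases h : ∃ z, N x z <;> by_cases h' : ∃ z, N y z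
    · obtain ⟨z, hz⟩ := h
      obtain ⟨w, hw⟩ := h'
      rw [hl x z hz, hl y w hw, Sum.inr.injEq] at hxy
      have h₁ := dist_triangle4 x z w y
      rw [dist_comm w y] at h₁
      linarith [hN_dist x z hz, hN_dist y w hw, hb₂ z hz.1 w hw.1 hxy]
    · obtain ⟨z, hz⟩ := h
      rw [hl x z hz, hl' y h'] at hxy
      cases hxy
    · obtain ⟨w, hw⟩ := h'
      rw [hl' x h, hl y w hw] at hxy
      cases hxy
    · rw [hl' x h, hl' y h', Sum.inl.injEq] at hxy
      linarith [ha₂ x (hmemA x hx h) y (hmemA y hy h') hxy]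

theorem HasMultiCover.mono {m n : ℕ} {r D : ℝ} {Z Z' : Set α} (h : HasMultiCover m n r D Z')
    (hZ : Z ⊆ Z') : HasMultiCover m n r D Z := by
  obtain ⟨A, h₁, h₂⟩ := h
  exact ⟨A, h₁, fun x hx => h₂ x (hZ hx)⟩

theorem HasMultiCover.preimage {m n : ℕ} {r D : ℝ} {Z : Set α} (h : HasMultiCover m n r D Z)
    {φ : α → α} (hφ : Isometry φ) : HasMultiCover m n r D (φ ⁻¹' Z) := by
  obtain ⟨A, h₁, h₂⟩ := h
  exact ⟨fun i => φ ⁻¹' A i, fun i hi => (h₁ i hi).preimage hφ, fun x hx => h₂ (φ x) hx⟩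

/-- Kolmogorov's trick: one more set can be added without increasing the number of sets missing
a point. -/
theorem HasMultiCover.succ {m n : ℕ} (hnm : n < m) {r D : ℝ} (hr : 0 < r) {Z : Set α}
    (h : HasMultiCover m n (3 * r) D Z) : HasMultiCover (m + 1) n r (D + 2 * r) Z := by
  classical
  obtain ⟨A, hA, hZ⟩ := h
  let T : ℕ → Set α := fun i => {x | ∃ a ∈ A i, dist x a ≤ r}
  have hAT : ∀ i, A i ⊆ T i := fun i x hx => ⟨x, hx, by rw [dist_self]; exact hr.le⟩
  have hsub : ∀ x, missingIndices T m x ⊆ missingIndices A m x := fun x i hi =>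
    mem_missingIndices.2 ((mem_missingIndices.1 hi).imp_right fun hx hxA => hx (hAT i hxA))
  let E : Set α := {x | x ∈ Z ∧ n ≤ (missingIndices T m x).card}
  have hE : ∀ x ∈ E, ∀ i < m, x ∈ T i → x ∈ A i := by
    intro x hx i hi hxi
    have := Finset.eq_of_subset_of_card_le (hsub x) ((hZ x hx.1).trans hx.2)
    by_contra hxA
    have hmem := mem_missingIndices.2 ⟨hi, hxA⟩
    rw [← this, mem_missingIndices] at hmem
    exact hmem.2 hxi
  refine ⟨fun i => if i < m then T i else E, fun i hi => ?_, fun x hx => ?_⟩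
  · by_cases him : i < m
    · simpa only [him, if_true] using (hA i him).thicken
    simp only [him, if_false]
    choose! l hl₁ hl₂ using fun i (hi : i < m) => (hA i hi).exists_label
    refine .of_label (fun x (i : Fin m) => if x ∈ A i then some (l i x) else none)
      (fun x hx y hy hxy => ?_) fun x hx y hy hxy => ?_
    · funext j
      by_cases hxj : x ∈ A j
      · have hyj : y ∈ A j := hE y hy j j.2 ⟨x, hxj, by rwa [dist_comm]⟩
        simp only [hxj, hyj, if_true, hl₁ j j.2 x hxj y hyj (by linarith)]
      · have hyj : y ∉ A j := fun hyj => hxj (hE x hx j j.2 ⟨y, hyj, hxy⟩)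
        simp only [hxj, hyj, if_false]
    · obtain ⟨j, hj, hxj⟩ := exists_mem_of_card_missingIndices_lt ((hZ x hx.1).trans_lt hnm)
      have hj' := congrFun hxy ⟨j, hj⟩
      by_cases hyj : y ∈ A j
      · simp only [hxj, hyj, if_true, Option.some.injEq] at hj'
        linarith [hl₂ j hj x hxj y hyj hj']
      · simp [hxj, hyj] at hj'
  · by_cases hxE : x ∈ E
    · refine (Finset.card_le_card fun i hi => ?_).trans (hZ x hx)
      obtain ⟨-, hxi⟩ := mem_missingIndices.1 hi
      by_cases him : i < m
      · rw [if_pos him] at hxi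
        exact hsub x (mem_missingIndices.2 ⟨him, hxi⟩)
      · exact absurd hxE (by rwa [if_neg him] at hxi)
    · have hlt : (missingIndices T m x).card < n := not_le.1 fun hle => hxE ⟨hx, hle⟩
      refine (Finset.card_le_card fun i hi => ?_).trans
        ((Finset.card_insert_le m (missingIndices T m x)).trans hlt)
      obtain ⟨hi, hxi⟩ := mem_missingIndices.1 hi
      rcases Nat.lt_succ_iff_lt_or_eq.1 hi with him | rfl
      · rw [if_pos him] at hxi
        exact Finset.mem_insert_of_mem (mem_missingIndices.2 ⟨him, hxi⟩)
      · exact Finset.mem_insert_self _ _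

theorem UniformMultiCover.add {m n : ℕ} (hnm : n < m) {𝒵 : Set (Set α)}
    (h : UniformMultiCover m n 𝒵) (j : ℕ) : UniformMultiCover (m + j) n 𝒵 := by
  induction j with
  | zero => exact h
  | succ j ih =>
    intro r hr
    obtain ⟨D, hD, hcov⟩ := ih (3 * r) (by positivity)
    exact ⟨D + 2 * r, by positivity, fun Z hZ => (hcov Z hZ).succ (by omega) hr⟩

theorem AsdimLED.hasMultiCover_range {β : Type*} {φ : β → α} {n : ℕ}
    (h : AsdimLED (fun a b => dist (φ a) (φ b)) n) {r : ℝ} (hr : 0 < r) :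
    ∃ D : ℝ, 0 ≤ D ∧ HasMultiCover (n + 1) n r D (range φ) := by
  obtain ⟨𝒰, D, hcov, hdis, hdiam⟩ := h r hr
  let A : ℕ → Set α := fun i => {x | ∃ hi : i < n + 1, ∃ U ∈ 𝒰 ⟨i, hi⟩, ∃ b ∈ U, φ b = x}
  refine ⟨max D 0, le_max_right _ _, A, fun i hi => ?_, ?_⟩
  · have hA : ∀ x ∈ A i, ∃ U ∈ 𝒰 ⟨i, hi⟩, ∃ b ∈ U, φ b = x := fun x ⟨_, hx⟩ => hx
    choose! u hu b hb hφ using hA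
    refine .of_label u (fun x hx y hy hxy => ?_) fun x hx y hy hxy => ?_
    · by_contra hne
      have := hdis ⟨i, hi⟩ _ (hu x hx) _ (hu y hy) hne _ (hb x hx) _ (hb y hy)
      simp only [hφ x hx, hφ y hy] at this
      linarith
    · have := hdiam ⟨i, hi⟩ _ (hu x hx) _ (hb x hx) _ (hxy ▸ hb y hy)
      simp only [hφ x hx, hφ y hy] at this
      exact this.trans (le_max_left _ _)
  · rintro _ ⟨b, rfl⟩
    obtain ⟨i, U, hU, hb⟩ := hcov b
    have : missingIndices A (n + 1) (φ b) ⊂ Finset.range (n + 1) := by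
      refine (Finset.ssubset_iff_of_subset fun j hj =>
        Finset.mem_range.2 (mem_missingIndices.1 hj).1).2 ⟨i, Finset.mem_range.2 i.2, fun hno => ?_⟩
      exact (mem_missingIndices.1 hno).2 ⟨i.2, U, hU, b, hb, rfl⟩
    have := Finset.card_lt_card this
    rw [Finset.card_range] at this
    omega

theorem HasMultiCover.exists_families {n : ℕ} {r D : ℝ}
    (h : HasMultiCover (n + 1) n r D (univ : Set α)) :
    ∃ 𝒰 : Fin (n + 1) → Set (Set α),
      (∀ x : α, ∃ i, ∃ U ∈ 𝒰 i, x ∈ U) ∧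
      (∀ i, RDisjointD dist r (𝒰 i)) ∧
      (∀ i, ∀ U ∈ 𝒰 i, DiamLED dist D U) := by
  obtain ⟨A, hA, hcov⟩ := h
  choose! l hl₁ hl₂ using fun i (hi : i < n + 1) => (hA i hi).exists_label
  refine ⟨fun i => range fun c => {x | x ∈ A i ∧ l i x = c}, fun x => ?_, ?_, ?_⟩
  · obtain ⟨i, hi, hx⟩ :=
      exists_mem_of_card_missingIndices_lt (Nat.lt_succ_of_le (hcov x (mem_univ x)))
    exact ⟨⟨i, hi⟩, _, ⟨l i x, rfl⟩, hx, rfl⟩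
  · rintro i _ ⟨c, rfl⟩ _ ⟨c', rfl⟩ hne x ⟨hx, hxc⟩ y ⟨hy, hyc⟩
    by_contra! hle
    have := hl₁ i i.2 x hx y hy hle
    rw [hxc, hyc] at this
    exact hne (by rw [this])
  · rintro i _ ⟨c, rfl⟩ x ⟨hx, hxc⟩ y ⟨hy, hyc⟩
    exact hl₂ i i.2 x hx y hy (hxc.trans hyc.symm)

end CoarseCovers

section Hurewicz

variable {α β : Type*} [PseudoMetricSpace α] [PseudoMetricSpace β]

/-- The preimages under `f` of the sets of diameter at most `R`. -/
def boundedPreimages (f : α → β) (R : ℝ) : Set (Set α) :=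
  {Z | ∃ I : Set β, DiamLED dist R I ∧ Z = f ⁻¹' I}

/-- Multicovers over the cells of `Y 0, …, Y (t - 1)` merge into one family of sets which splits over
each class of the labelling `v i`, provided these classes are small compared to the distance
between cells. -/
theorem exists_sets_splitting_over_labels {m n : ℕ} {f : α → β} {ι : Type*}
    (hfib : ∀ R, UniformMultiCover m n (boundedPreimages f R))
    {V : ℕ → Set β} {v : ℕ → β → ι} {R₁ R₂ : ℝ}
    (hV : ∀ i < m, ∀ x ∈ V i, ∀ y ∈ V i, v i x = v i y → dist x y ≤ R₁)
    {Y : ℕ → Set β} {r : ℝ} (hr : 0 < r) (t : ℕ)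
    (hY : ∀ j < t, SplitsAtScale R₁ R₂ (Y j)) :
    ∃ D : ℝ, 0 ≤ D ∧ ∃ B : ℕ → Set α,
      (∀ i < m, ∀ c, SplitsAtScale r D (B i ∩ {x | f x ∈ V i ∧ v i (f x) = c})) ∧
      ∀ x, (∃ j < t, f x ∈ Y j) → (missingIndices B m x).card ≤ n := by
  induction t with
  | zero =>
    refine ⟨0, le_rfl, fun _ => ∅, fun i _ c => ?_, fun x ⟨j, hj, _⟩ => absurd hj (by simp)⟩
    rw [empty_inter]
    exact .empty _ _
  | succ t ih =>
    obtain ⟨D, hD, B, hB, hBcov⟩ := ih fun j hj => hY j (by omega)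
    obtain ⟨D', hD', hU⟩ := hfib R₂ (D + 2 * r) (by positivity)
    obtain ⟨l, hl₁, hl₂⟩ := (hY t (by omega)).exists_label
    have hcell : ∀ c, HasMultiCover m n (D + 2 * r) D' (f ⁻¹' {y | y ∈ Y t ∧ l y = c}) :=
      fun c => hU _ ⟨_, fun x hx y hy => hl₂ x hx.1 y hy.1 (hx.2.trans hy.2.symm), rfl⟩
    choose U hU₁ hU₂ using hcell
    let C : ℕ → Set α := fun i => {x | f x ∈ Y t ∧ x ∈ U (l (f x)) i}
    refine ⟨D' + 2 * D + 2 * r, by positivity, fun i => B i ∪ C i, fun i hi c => ?_, ?_⟩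
    · rw [union_inter_distrib_right]
      refine (hB i hi c).union hr hD hD' ?_
      rcases (C i ∩ {x | f x ∈ V i ∧ v i (f x) = c}).eq_empty_or_nonempty with h | ⟨z, hz⟩
      · rw [h]
        exact .empty _ _
      · refine (hU₁ (l (f z)) i hi).mono fun x hx => ?_
        rw [hl₁ (f z) hz.1.1 (f x) hx.1.1
          (hV i hi _ hz.2.1 _ hx.2.1 (hz.2.2.trans hx.2.2.symm))]
        exact hx.1.2
    · rintro x ⟨j, hj, hxj⟩
      rcases Nat.lt_succ_iff_lt_or_eq.1 hj with hj | rfl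
      · refine (Finset.card_le_card fun i hi => ?_).trans (hBcov x ⟨j, hj, hxj⟩)
        exact mem_missingIndices.2 ((mem_missingIndices.1 hi).imp_right fun h hx => h (Or.inl hx))
      · refine (Finset.card_le_card fun i hi => ?_).trans (hU₂ (l (f x)) x ⟨hxj, rfl⟩)
        exact mem_missingIndices.2
          ((mem_missingIndices.1 hi).imp_right fun h hx => h (Or.inr ⟨hxj, hx⟩))

/-- Hurewicz theorem for asymptotic dimension. -/
theorem asdimLED_of_boundedPreimages {f : α → β}
    (hf : ∀ r : ℝ, ∃ ρ : ℝ, 0 < ρ ∧ ∀ x y, dist x y ≤ r → dist (f x) (f y) ≤ ρ) {n k : ℕ}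
    (hfib : ∀ R, UniformMultiCover (n + 1) n (boundedPreimages f R))
    (hβ : UniformMultiCover (k + 1) k {(univ : Set β)}) :
    AsdimLED (dist : α → α → ℝ) (k + n) := by
  intro r hr
  obtain ⟨ρ, hρ, hfρ⟩ := hf r
  have hβ' : UniformMultiCover (k + n + 1) k {(univ : Set β)} := by
    have := hβ.add (by omega) n
    rwa [add_right_comm] at this
  have hfib' : ∀ R, UniformMultiCover (k + n + 1) n (boundedPreimages f R) := fun R => by
    have := (hfib R).add (by omega) k
    rwa [show n + 1 + k = k + n + 1 by omega] at this
  obtain ⟨R₁, hR₁, hV⟩ := hβ' ρ hρ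
  obtain ⟨V, hV, hVcov⟩ := hV univ rfl
  choose! v hv₁ hv₂ using fun i (hi : i < k + n + 1) => (hV i hi).exists_label
  obtain ⟨R₂, -, hY⟩ := hβ (R₁ + 1) (by positivity)
  obtain ⟨Y, hY, hYcov⟩ := hY univ rfl
  obtain ⟨D, -, B, hB, hBcov⟩ := exists_sets_splitting_over_labels hfib'
    (fun i hi x hx y hy h => (hv₂ i hi x hx y hy h).trans (le_add_of_nonneg_right zero_le_one))
    hr (k + 1) hY
  have hmulti : HasMultiCover (k + n + 1) (k + n) r D (univ : Set α) := by
    refine ⟨fun i => B i ∩ f ⁻¹' V i, fun i hi => ?_, fun x _ => ?_⟩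
    · choose l hl₁ hl₂ using fun c => (hB i hi c).exists_label
      refine .of_label (fun x => (v i (f x), l (v i (f x)) x)) (fun x hx y hy hxy => ?_)
        fun x hx y hy hxy => ?_
      · have h := hv₁ i hi _ hx.2 _ hy.2 (hfρ x y hxy)
        have h' := hl₁ (v i (f y)) x ⟨hx.1, hx.2, h⟩ y ⟨hy.1, hy.2, rfl⟩ hxy
        simp only [h, h']
      · obtain ⟨h, h'⟩ := Prod.mk.inj hxy
        rw [h] at h'
        exact hl₂ (v i (f y)) x ⟨hx.1, hx.2, h⟩ y ⟨hy.1, hy.2, rfl⟩ h'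
    · have hxY : ∃ j < k + 1, f x ∈ Y j :=
        exists_mem_of_card_missingIndices_lt (Nat.lt_succ_of_le (hYcov (f x) (mem_univ _)))
      have h₁ := hBcov x hxY
      have h₂ := hVcov (f x) (mem_univ _)
      have hsub : missingIndices (fun i => B i ∩ f ⁻¹' V i) (k + n + 1) x ⊆
          missingIndices B (k + n + 1) x ∪ missingIndices V (k + n + 1) (f x) := fun i hi => by
        obtain ⟨hi, hx⟩ := mem_missingIndices.1 hi
        rw [Finset.mem_union, mem_missingIndices, mem_missingIndices, ← and_or_left]
        exact ⟨hi, not_and_or.1 hx⟩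
      have := (Finset.card_le_card hsub).trans (Finset.card_union_le _ _)
      omega
  obtain ⟨𝒰, h⟩ := hmulti.exists_families
  exact ⟨𝒰, D, h⟩

end Hurewicz

section WordMetric

variable {Γ : Type*} [Group Γ] {S : Set Γ}

theorem exists_list_length_eq_wordNorm (hsymm : ∀ s ∈ S, s⁻¹ ∈ S)
    (hgen : Subgroup.closure S = ⊤) (g : Γ) :
    ∃ l : List Γ, (∀ s ∈ l, s ∈ S) ∧ l.length = wordNorm S g ∧ l.prod = g := by
  refine Nat.sInf_mem (s := {n | ∃ l : List Γ, (∀ s ∈ l, s ∈ S) ∧ l.length = n ∧ l.prod = g}) ?_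
  have hg : g ∈ (Subgroup.closure S).toSubmonoid := hgen ▸ Subgroup.mem_top g
  rw [Subgroup.closure_toSubmonoid] at hg
  obtain ⟨l, hl, hg⟩ := Submonoid.exists_list_of_mem_closure hg
  refine ⟨l.length, l, fun s hs => (hl s hs).elim id fun h => ?_, rfl, hg⟩
  simpa using hsymm _ h

theorem wordNorm_prod_le {l : List Γ} (hl : ∀ s ∈ l, s ∈ S) : wordNorm S l.prod ≤ l.length :=
  Nat.sInf_le ⟨l, hl, rfl, rfl⟩

theorem wordNorm_one : wordNorm S (1 : Γ) = 0 :=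
  Nat.le_zero.1 (wordNorm_prod_le (l := []) (by simp))

theorem wordNorm_mul_le (hsymm : ∀ s ∈ S, s⁻¹ ∈ S) (hgen : Subgroup.closure S = ⊤) (g h : Γ) :
    wordNorm S (g * h) ≤ wordNorm S g + wordNorm S h := by
  obtain ⟨l, hl, hlen, hg⟩ := exists_list_length_eq_wordNorm hsymm hgen g
  obtain ⟨l', hl', hlen', hh⟩ := exists_list_length_eq_wordNorm hsymm hgen h
  rw [← hlen, ← hlen', ← hg, ← hh, ← List.prod_append, ← List.length_append]
  exact wordNorm_prod_le fun s hs => (List.mem_append.1 hs).elim (hl s) (hl' s)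

theorem wordNorm_inv_le (hsymm : ∀ s ∈ S, s⁻¹ ∈ S) (hgen : Subgroup.closure S = ⊤) (g : Γ) :
    wordNorm S g⁻¹ ≤ wordNorm S g := by
  obtain ⟨l, hl, hlen, hg⟩ := exists_list_length_eq_wordNorm hsymm hgen g
  rw [← hlen, ← hg, List.prod_inv_reverse]
  refine (wordNorm_prod_le fun s hs => ?_).trans (by simp)
  obtain ⟨a, ha, rfl⟩ := List.mem_map.1 (List.mem_reverse.1 hs)
  exact hsymm a (hl a ha)

/-- The word metric as a pseudometric space structure. -/
noncomputable abbrev wordPseudoMetricSpace (hsymm : ∀ s ∈ S, s⁻¹ ∈ S)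
    (hgen : Subgroup.closure S = ⊤) : PseudoMetricSpace Γ where
  dist := wordDist S
  dist_self g := by simp [wordDist, wordNorm_one]
  dist_comm g h := by
    have key : ∀ a b : Γ, wordNorm S (a⁻¹ * b) ≤ wordNorm S (b⁻¹ * a) := fun a b => by
      simpa using wordNorm_inv_le hsymm hgen (b⁻¹ * a)
    exact congrArg Nat.cast ((key g h).antisymm (key h g))
  dist_triangle a b c := by
    have := wordNorm_mul_le hsymm hgen (a⁻¹ * b) (b⁻¹ * c)
    rw [show a⁻¹ * b * (b⁻¹ * c) = a⁻¹ * c by group] at this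
    change (wordNorm S (a⁻¹ * c) : ℝ) ≤ wordNorm S (a⁻¹ * b) + wordNorm S (b⁻¹ * c)
    exact_mod_cast this

theorem exists_dist_smul_le_wordNorm (hfin : S.Finite) (hsymm : ∀ s ∈ S, s⁻¹ ∈ S)
    (hgen : Subgroup.closure S = ⊤) {X : Type*} [PseudoMetricSpace X] [MulAction Γ X]
    (hiso : ∀ (g : Γ) (x y : X), dist (g • x) (g • y) = dist x y) (x₀ : X) :
    ∃ L : ℝ, 0 ≤ L ∧ ∀ g : Γ, dist (g • x₀) x₀ ≤ L * wordNorm S g := by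
  obtain ⟨L, hL⟩ := (hfin.image fun s => dist (s • x₀) x₀).bddAbove
  have hS : ∀ s ∈ S, dist (s • x₀) x₀ ≤ max L 0 := fun s hs =>
    (hL (mem_image_of_mem _ hs)).trans (le_max_left _ _)
  refine ⟨max L 0, le_max_right _ _, fun g => ?_⟩
  obtain ⟨l, hl, hlen, rfl⟩ := exists_list_length_eq_wordNorm hsymm hgen g
  rw [← hlen]
  clear hlen
  induction l with
  | nil => simp
  | cons s l ih =>
    have h₁ := ih fun a ha => hl a (List.mem_cons_of_mem _ ha)
    have h₂ := hS s (hl s List.mem_cons_self)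
    have h₃ := dist_triangle (s • l.prod • x₀) (s • x₀) x₀
    rw [hiso] at h₃
    rw [List.prod_cons, mul_smul, List.length_cons]
    push_cast
    linarith

end WordMetric

/-- If a finitely generated group `Γ` (with the word metric) acts by isometries on a geodesic
metric space `X` with `asdim X ≤ k`, and every `R`-stabilizer
`W_R(x₀) = {g : d(g x₀, x₀) ≤ R}` (as a subspace of `Γ`) has asymptotic dimension at most
`n`, then `asdim Γ ≤ k + n`. -/
theorem asdim_group_acting_on_geodesic {Γ : Type*} [Group Γ] (S : Set Γ)
    (hfin : S.Finite) (hsymm : ∀ s ∈ S, s⁻¹ ∈ S) (hgen : Subgroup.closure S = ⊤)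
    {X : Type*} [MetricSpace X] [MulAction Γ X]
    (hgeo : IsGeodesicSpace X)
    (hiso : ∀ (g : Γ) (x y : X), dist (g • x) (g • y) = dist x y)
    (x₀ : X) (n k : ℕ)
    (hW : ∀ R : ℝ, 0 < R →
      AsdimLED (fun a b : {g : Γ // dist (g • x₀) x₀ ≤ R} => wordDist S a.1 b.1) n)
    (hX : AsdimLED (fun x y : X => dist x y) k) :
    AsdimLED (wordDist S) (k + n) := by
  let _ := wordPseudoMetricSpace hsymm hgen
  have hfdist : ∀ g h : Γ, dist (g • x₀) (h • x₀) = dist ((g⁻¹ * h) • x₀) x₀ := fun g h => by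
    rw [← hiso g⁻¹, inv_smul_smul, mul_smul, dist_comm]
  refine asdimLED_of_boundedPreimages (f := fun g : Γ => g • x₀) (fun r => ?_) (fun R r hr => ?_)
    fun r hr => ?_
  · obtain ⟨L, hL, hLip⟩ := exists_dist_smul_le_wordNorm hfin hsymm hgen hiso x₀
    refine ⟨L * |r| + 1, by positivity, fun g h hgh => ?_⟩
    have h₁ : (wordNorm S (g⁻¹ * h) : ℝ) ≤ |r| := le_trans hgh (le_abs_self r)
    rw [hfdist]
    linarith [hLip (g⁻¹ * h), mul_le_mul_of_nonneg_left h₁ hL]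
  · obtain ⟨D, hD, hcov⟩ := AsdimLED.hasMultiCover_range
      (φ := (Subtype.val : {g : Γ // dist (g • x₀) x₀ ≤ |R| + 1} → Γ)) (hW (|R| + 1) (by positivity)) hr
    refine ⟨D, hD, ?_⟩
    rintro _ ⟨I, hI, rfl⟩
    rcases ((fun g : Γ => g • x₀) ⁻¹' I).eq_empty_or_nonempty with h | ⟨g, hg⟩
    · rw [h]
      exact hcov.mono (empty_subset _)
    · have hleft : Isometry fun h : Γ => g⁻¹ * h := Isometry.of_dist_eq fun a b => by
        change wordDist S _ _ = wordDist S _ _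
        simp [wordDist, mul_assoc]
      refine (hcov.preimage hleft).mono fun h hh => ?_
      have h₁ : dist ((g⁻¹ * h) • x₀) x₀ ≤ |R| + 1 := by
        rw [← hfdist]
        linarith [hI _ hg _ hh, le_abs_self R]
      exact ⟨⟨g⁻¹ * h, h₁⟩, rfl⟩
  · obtain ⟨D, hD, hcov⟩ := AsdimLED.hasMultiCover_range (φ := (id : X → X)) hX hr
    rw [range_id] at hcov
    exact ⟨D, hD, fun Z hZ => by rwa [mem_singleton_iff.1 hZ]⟩
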